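/- arXiv:1810.11039 — 2 statements merged into one kernel-verified Lean document; each statement's English description precedes it below -/
import Mathlib

section
/- Let T > 0, let ρ : [0,T] → ℝ be a measurable function with 0 ≤ ρ(s) ≤ 1 for all s, and let m : [0,T] → ℝ be a nondecreasing function with 0 ≤ m(t) ≤ t for all t ∈ [0,T]. Suppose that t·m(t) = ∫_0^t (s·ρ(s) + m(s)) ds for all t ∈ [0,T]. Then m(t) = ∫_0^t ρ(s) ds for every t ∈ [0,T]. -/
open MeasureTheory Set intervalIntegral

/-- Integration by parts of `s * f s`, for a function `f` that is merely integrable. -/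
theorem mul_integral_eq_integral_mul_add_integral {f : ℝ → ℝ} {t : ℝ}
    (hf : IntervalIntegrable f volume 0 t) :
    t * ∫ s in (0 : ℝ)..t, f s =
      ∫ s in (0 : ℝ)..t, (s * f s + ∫ u in (0 : ℝ)..s, f u) := by
  have hid : AbsolutelyContinuousOnInterval (fun x : ℝ => x) 0 t :=
    contDiff_id.contDiffOn.absolutelyContinuousOnInterval
  have hF : AbsolutelyContinuousOnInterval (fun x => ∫ u in (0 : ℝ)..x, f u) 0 t :=
    hf.absolutelyContinuousOnInterval_intervalIntegral (by simp)
  have h := hid.integral_deriv_mul_eq_sub hF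
  rw [zero_mul, sub_zero] at h
  rw [← h]
  apply intervalIntegral.integral_congr_ae
  filter_upwards [hf.ae_hasDerivAt_integral] with x hx hxt
  have hderiv := (hx (uIoc_subset_uIcc hxt) 0 (by simp)).deriv
  rw [hderiv, deriv_id'']
  ring

/-- A function `d` with `|d t| ≤ t` and `t * d t = ∫₀ᵗ d` on `[0, T]` vanishes there. -/
theorem eq_zero_of_mul_eq_integral {d : ℝ → ℝ} {T : ℝ}
    (hd : ∀ t ∈ Icc (0 : ℝ) T, |d t| ≤ t)
    (heq : ∀ t ∈ Icc (0 : ℝ) T, t * d t = ∫ s in (0 : ℝ)..t, d s) :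
    ∀ t ∈ Icc (0 : ℝ) T, d t = 0 := by
  have key : ∀ n : ℕ, ∀ t ∈ Icc (0 : ℝ) T, |d t| ≤ t * (1 / 2) ^ n := by
    intro n
    induction n with
    | zero => simpa using hd
    | succ n ih =>
      intro t ht
      rcases ht.1.eq_or_lt with rfl | hpos
      · simpa using hd 0 ht
      have hb : ‖∫ s in (0 : ℝ)..t, d s‖ ≤ ∫ s in (0 : ℝ)..t, s * (1 / 2) ^ n :=
        intervalIntegral.norm_integral_le_of_norm_le ht.1
          (Filter.Eventually.of_forall fun s hs => ih s ⟨hs.1.le, hs.2.trans ht.2⟩)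
          (Continuous.intervalIntegrable (by fun_prop) _ _)
      rw [← heq t ht, intervalIntegral.integral_mul_const, integral_id, Real.norm_eq_abs,
        abs_mul, abs_of_pos hpos] at hb
      refine le_of_mul_le_mul_left (hb.trans_eq ?_) hpos
      ring
  intro t ht
  have hlim : Filter.Tendsto (fun n : ℕ => t * (1 / 2 : ℝ) ^ n) Filter.atTop (nhds 0) := by
    simpa using (tendsto_pow_atTop_nhds_zero_of_lt_one (by norm_num : (0 : ℝ) ≤ 1 / 2)
      (by norm_num)).const_mul t
  exact abs_nonpos_iff.mp (ge_of_tendsto' hlim fun n => key n t ht)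

/-- Analytic core of Proposition 4.3(a): if `ρ : [0,T] → [0,1]` is measurable,
`m : [0,T] → ℝ` is nondecreasing with `0 ≤ m(t) ≤ t`, and
`t·m(t) = ∫_0^t (s·ρ(s) + m(s)) ds` on `[0,T]`, then `m(t) = ∫_0^t ρ(s) ds`. -/
theorem integral_equation_unique_solution
    (T : ℝ) (hT : 0 < T) (ρ m : ℝ → ℝ)
    (hρmeas : Measurable ρ)
    (hρ : ∀ s ∈ Set.Icc (0 : ℝ) T, 0 ≤ ρ s ∧ ρ s ≤ 1)
    (hmono : MonotoneOn m (Set.Icc (0 : ℝ) T))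
    (hm : ∀ t ∈ Set.Icc (0 : ℝ) T, 0 ≤ m t ∧ m t ≤ t)
    (heq : ∀ t ∈ Set.Icc (0 : ℝ) T, t * m t = ∫ s in (0 : ℝ)..t, (s * ρ s + m s)) :
    ∀ t ∈ Set.Icc (0 : ℝ) T, m t = ∫ s in (0 : ℝ)..t, ρ s := by
  have hρint : ∀ t ∈ Icc (0 : ℝ) T, IntervalIntegrable ρ volume 0 t := by
    intro t ht
    refine (intervalIntegrable_const (c := (1 : ℝ))).mono_fun hρmeas.aestronglyMeasurable ?_
    refine (ae_restrict_iff' measurableSet_uIoc).2 (Filter.Eventually.of_forall fun s hs => ?_)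
    rw [uIoc_of_le ht.1] at hs
    have h := hρ s ⟨hs.1.le, hs.2.trans ht.2⟩
    simpa [abs_of_nonneg h.1] using h.2
  have hR : ∀ t ∈ Icc (0 : ℝ) T,
      0 ≤ ∫ s in (0 : ℝ)..t, ρ s ∧ ∫ s in (0 : ℝ)..t, ρ s ≤ t := by
    intro t ht
    have hsub : ∀ s ∈ Icc (0 : ℝ) t, 0 ≤ ρ s ∧ ρ s ≤ 1 :=
      fun s hs => hρ s ⟨hs.1, hs.2.trans ht.2⟩
    refine ⟨intervalIntegral.integral_nonneg ht.1 fun s hs => (hsub s hs).1, ?_⟩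
    simpa using intervalIntegral.integral_mono_on ht.1 (hρint t ht)
      (intervalIntegrable_const (c := (1 : ℝ))) fun s hs => (hsub s hs).2
  have hzero := eq_zero_of_mul_eq_integral (T := T)
    (d := fun t => m t - ∫ s in (0 : ℝ)..t, ρ s) ?_ ?_
  · exact fun t ht => sub_eq_zero.mp (hzero t ht)
  · intro t ht
    rw [abs_le]
    constructor <;> linarith [(hm t ht).1, (hm t ht).2, (hR t ht).1, (hR t ht).2]
  · intro t ht
    have hmint : IntervalIntegrable m volume 0 t := by
      apply MonotoneOn.intervalIntegrable
      rw [uIcc_of_le ht.1]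
      exact hmono.mono (Icc_subset_Icc_right ht.2)
    have hsρ : IntervalIntegrable (fun s => s * ρ s) volume 0 t :=
      (hρint t ht).continuousOn_mul continuousOn_id
    have hRint : IntervalIntegrable (fun s => ∫ u in (0 : ℝ)..s, ρ u) volume 0 t :=
      ((hρint t ht).absolutelyContinuousOnInterval_intervalIntegral
        (by simp)).continuousOn.intervalIntegrable
    rw [mul_sub, heq t ht, mul_integral_eq_integral_mul_add_integral (hρint t ht),
      intervalIntegral.integral_add hsρ hmint, intervalIntegral.integral_add hsρ hRint,
      intervalIntegral.integral_sub hmint hRint]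
    ring
end

section
/- Let a > 0 and define f : (0,1] → ℝ by f(x) = log(1+x)/(1 + a·x). Then f(1) ≥ f(x) for all x ∈ (0,1] if and only if 1/a ≥ 2·log 2 − 1. -/
/-- Remark 4.8 criterion: for `a > 0` and `f(x) = log(1+x)/(1+ax)` on `(0,1]`,
`f(1) ≥ f(x)` for all `x ∈ (0,1]` if and only if `1/a ≥ 2·log 2 - 1`. -/
theorem log_ratio_endpoint_max_iff (a : ℝ) (ha : 0 < a) :
    (∀ x ∈ Set.Ioc (0 : ℝ) 1,
        Real.log (1 + x) / (1 + a * x) ≤ Real.log (1 + 1) / (1 + a * 1)) ↔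
      2 * Real.log 2 - 1 ≤ 1 / a := by
  have hlog : ∀ x : ℝ, 0 < x → Real.log (1 + x) = Real.log 2 + Real.log ((1 + x) / 2) := by
    intro x hx
    rw [Real.log_div (by positivity) (by norm_num)]
    ring
  rw [le_div_iff₀ ha, one_add_one_eq_two, mul_one]
  have hL1 : Real.log 2 < 1 := by linarith [Real.log_two_lt_d9]
  have hL0 : 0 < Real.log 2 := Real.log_pos (by norm_num)
  constructor
  · intro h
    by_contra! hlt
    obtain ⟨c, hc⟩ : ∃ c, c * (1 + a) = Real.log 2 * a :=
      ⟨Real.log 2 * a / (1 + a), div_mul_cancel₀ _ (by positivity)⟩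
    have hc1 : c < 1 := by
      by_contra! hc1
      nlinarith
    have hc2 : 1 / 2 < c := by
      by_contra! hc2
      nlinarith
    have hx : 0 < 2 - 2 * c := by linarith
    have key := h (2 - 2 * c) ⟨hx, by linarith⟩
    rw [div_le_div_iff₀ (by positivity) (by positivity), hlog _ hx] at key
    have hlow := Real.one_sub_inv_le_log_of_pos (x := (1 + (2 - 2 * c)) / 2) (by linarith)
    have hupp : Real.log ((1 + (2 - 2 * c)) / 2) ≤ -((2 * c - 1) * c) := by
      refine le_of_mul_le_mul_right (a := 1 + a) ?_ (by positivity)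
      linear_combination key + (2 * c - 1) * hc
    have hinv : 1 + (2 * c - 1) * c ≤ ((1 + (2 - 2 * c)) / 2)⁻¹ := by linarith
    rw [← one_div, le_div_iff₀ (by linarith)] at hinv
    nlinarith [mul_pos (sub_pos.2 hc1) (sub_pos.2 hc2),
      mul_pos (mul_pos (sub_pos.2 hc1) (sub_pos.2 hc2)) (sub_pos.2 hc2)]
  · rintro h x ⟨hx0, hx1⟩
    rw [div_le_div_iff₀ (by positivity) (by positivity), hlog x hx0]
    have htan := Real.log_le_sub_one_of_pos (x := (1 + x) / 2) (by positivity)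
    nlinarith [mul_le_mul_of_nonneg_right htan (by positivity : 0 ≤ 1 + a),
      mul_nonneg (sub_nonneg.2 hx1) (sub_nonneg.2 h)]
end
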